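/- arXiv:2203.00651 — 2 statements merged into one kernel-verified Lean document; each statement's English description precedes it below -/
import Mathlib

section
/- Fix real numbers x > 0 and r > 0, and define α(s) := √(x² + λ(s)²·r²)/λ(s) and β(s) := x·s/√(x² + λ(s)²·r²). Then the function s ↦ α(s)·λ(β(s)) is strictly decreasing on (0, +∞). -/
open Real

noncomputable def erf (t : ℝ) : ℝ := (2 / Real.sqrt π) * ∫ s in (0:ℝ)..t, Real.exp (-s^2)

noncomputable def lam (s : ℝ) : ℝ := Real.exp (-s^2/2) + Real.sqrt (π/2) * s * erf (s / Real.sqrt 2)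

noncomputable def gaussPrimitive (t : ℝ) : ℝ := ∫ v in (0:ℝ)..t, Real.exp (-v ^ 2 / 2)

lemma continuous_exp_neg_sq_div_two : Continuous fun v : ℝ => Real.exp (-v ^ 2 / 2) := by
  fun_prop

lemma hasDerivAt_gaussPrimitive (t : ℝ) :
    HasDerivAt gaussPrimitive (Real.exp (-t ^ 2 / 2)) t :=
  continuous_exp_neg_sq_div_two.integral_hasStrictDerivAt 0 t |>.hasDerivAt

lemma gaussPrimitive_pos {t : ℝ} (ht : 0 < t) : 0 < gaussPrimitive t :=
  intervalIntegral.intervalIntegral_pos_of_pos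
    (continuous_exp_neg_sq_div_two.intervalIntegrable 0 t) (fun _ => Real.exp_pos _) ht

lemma lam_eq (s : ℝ) : lam s = Real.exp (-s ^ 2 / 2) + s * gaussPrimitive s := by
  have h2 : √(2 : ℝ) ≠ 0 := by positivity
  have hpi : √π ≠ 0 := by positivity
  have hsub : gaussPrimitive s = √2 * ∫ v in (0:ℝ)..(s / √2), Real.exp (-v ^ 2) := by
    have h := intervalIntegral.integral_comp_div (a := 0) (b := s)
      (fun v : ℝ => Real.exp (-v ^ 2)) h2
    simp only [zero_div, smul_eq_mul] at h
    rw [← h, gaussPrimitive]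
    refine intervalIntegral.integral_congr fun v _ => ?_
    simp only [div_pow, Real.sq_sqrt (zero_le_two : (0:ℝ) ≤ 2), neg_div]
  rw [lam, erf, hsub, Real.sqrt_div pi_pos.le]
  field_simp
  linear_combination (-(s * ∫ v in (0:ℝ)..(s / √2), Real.exp (-v ^ 2))) *
    Real.sq_sqrt (zero_le_two : (0:ℝ) ≤ 2)

lemma hasDerivAt_exp_neg_sq_div_two (s : ℝ) :
    HasDerivAt (fun v : ℝ => Real.exp (-v ^ 2 / 2)) (-s * Real.exp (-s ^ 2 / 2)) s := by
  refine (((hasDerivAt_pow 2 s).fun_neg).div_const 2).exp.congr_deriv ?_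
  push_cast
  ring

lemma hasDerivAt_lam (s : ℝ) : HasDerivAt lam (gaussPrimitive s) s := by
  rw [show lam = fun s => Real.exp (-s ^ 2 / 2) + s * gaussPrimitive s from funext lam_eq]
  refine ((hasDerivAt_exp_neg_sq_div_two s).fun_add
    ((hasDerivAt_id' s).fun_mul (hasDerivAt_gaussPrimitive s))).congr_deriv ?_
  ring

lemma lam_pos {s : ℝ} (hs : 0 < s) : 0 < lam s := by
  rw [lam_eq]
  have := gaussPrimitive_pos hs
  positivity

lemma gaussPrimitive_mul_lt {c s : ℝ} (hc : 0 < c) (hc1 : c < 1) (hs : 0 < s) :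
    gaussPrimitive (c * s) * Real.exp (-s ^ 2 / 2) <
      c * gaussPrimitive s * Real.exp (-(c * s) ^ 2 / 2) := by
  have hsub : gaussPrimitive (c * s) = c * ∫ v in (0:ℝ)..s, Real.exp (-(c * v) ^ 2 / 2) := by
    rw [intervalIntegral.integral_comp_mul_left (fun v : ℝ => Real.exp (-v ^ 2 / 2)) hc.ne',
      smul_eq_mul, mul_inv_cancel_left₀ hc.ne', mul_zero, gaussPrimitive]
  rw [hsub, mul_assoc, mul_assoc, gaussPrimitive]
  refine mul_lt_mul_of_pos_left ?_ hc
  rw [← intervalIntegral.integral_mul_const, ← intervalIntegral.integral_mul_const]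
  have hc2 : 0 < 1 - c ^ 2 := by nlinarith
  refine intervalIntegral.integral_lt_integral_of_continuousOn_of_le_of_exists_lt hs
    (by fun_prop) (by fun_prop) (fun v hv => ?_) ⟨0, ⟨le_rfl, hs.le⟩, ?_⟩
  · rw [← Real.exp_add, ← Real.exp_add, Real.exp_le_exp]
    have hv2 : v ^ 2 ≤ s ^ 2 := pow_le_pow_left₀ hv.1.le hv.2 2
    nlinarith [mul_nonneg hc2.le (sub_nonneg.2 hv2)]
  · rw [← Real.exp_add, ← Real.exp_add, Real.exp_lt_exp]
    nlinarith [mul_pos hc2 (pow_pos hs 2)]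

lemma hasDerivAt_renormalized_suppFunction {x r s : ℝ} (hx : 0 < x) (hs : 0 < s) :
    HasDerivAt (fun s =>
      Real.sqrt (x ^ 2 + lam s ^ 2 * r ^ 2) / lam s *
        lam (x * s / Real.sqrt (x ^ 2 + lam s ^ 2 * r ^ 2)))
      (x / lam s ^ 2 *
        (gaussPrimitive (x / √(x ^ 2 + lam s ^ 2 * r ^ 2) * s) * Real.exp (-s ^ 2 / 2) -
          x / √(x ^ 2 + lam s ^ 2 * r ^ 2) * gaussPrimitive s *
            Real.exp (-(x / √(x ^ 2 + lam s ^ 2 * r ^ 2) * s) ^ 2 / 2))) s := by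
  have hL := lam_pos hs
  have hpos : 0 < x ^ 2 + lam s ^ 2 * r ^ 2 := by positivity
  have hD : 0 < √(x ^ 2 + lam s ^ 2 * r ^ 2) := Real.sqrt_pos.2 hpos
  have hDsq := Real.sq_sqrt hpos.le
  have hd := ((((hasDerivAt_lam s).fun_pow 2).mul_const (r ^ 2)).const_add (x ^ 2)).sqrt hpos.ne'
  have hβ := ((hasDerivAt_id' s).const_mul x).fun_div hd hD.ne'
  have hlam := (hasDerivAt_lam (x * s / √(x ^ 2 + lam s ^ 2 * r ^ 2))).comp s hβ
  refine ((hd.fun_div (hasDerivAt_lam s) hL.ne').fun_mul hlam).congr_deriv ?_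
  have hLs := lam_eq s
  rw [Function.comp_apply, lam_eq (x * s / √(x ^ 2 + lam s ^ 2 * r ^ 2)),
    div_mul_eq_mul_div x _ s]
  clear hd hβ hlam
  generalize gaussPrimitive (x * s / √(x ^ 2 + lam s ^ 2 * r ^ 2)) = gβ
  generalize Real.exp (-(x * s / √(x ^ 2 + lam s ^ 2 * r ^ 2)) ^ 2 / 2) = eβ
  generalize √(x ^ 2 + lam s ^ 2 * r ^ 2) = D at *
  generalize Real.exp (-s ^ 2 / 2) = e at *
  generalize gaussPrimitive s = g at *
  generalize lam s = L at *
  obtain rfl : e = L - s * g := by linarith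
  field_simp
  push_cast
  linear_combination (-2 * g * D * eβ) * hDsq

theorem renormalized_suppFunction_strictAnti (x r : ℝ) (hx : 0 < x) (hr : 0 < r) :
    StrictAntiOn (fun s =>
      Real.sqrt (x ^ 2 + lam s ^ 2 * r ^ 2) / lam s *
        lam (x * s / Real.sqrt (x ^ 2 + lam s ^ 2 * r ^ 2))) (Set.Ioi (0 : ℝ)) := by
  refine strictAntiOn_of_deriv_neg (convex_Ioi 0)
    (fun s hs => (hasDerivAt_renormalized_suppFunction hx hs).continuousAt.continuousWithinAt)
    fun s hs => ?_
  rw [interior_Ioi] at hs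
  rw [(hasDerivAt_renormalized_suppFunction hx hs).deriv]
  have hL := lam_pos hs
  have hlt : x < √(x ^ 2 + lam s ^ 2 * r ^ 2) :=
    Real.lt_sqrt_of_sq_lt (lt_add_of_pos_right _ (by positivity))
  have hD := hx.trans hlt
  exact mul_neg_of_pos_of_neg (by positivity)
    (sub_neg.2 (gaussPrimitive_mul_lt (by positivity) ((div_lt_one hD).2 hlt) hs))
end

section
/- Fix real numbers x ∈ ℝ and r > 0, and define α(s) := √(x² + λ(s)²·r²)/λ(s) and β(s) := x·s/√(x² + λ(s)²·r²). Then lim_{s→+∞} α(s)·λ(β(s)) = φ∞(x, r). -/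
open Real Filter Classical

noncomputable def phiInf (x z : ℝ) : ℝ :=
  if z = 0 then |x| else |z| * Real.exp (-x^2 / (π * z^2)) + x * erf (x / (Real.sqrt π * |z|))

lemma continuous_erf : Continuous erf := by
  unfold erf
  refine continuous_const.mul ?_
  exact intervalIntegral.continuous_primitive
    (fun a b => (by fun_prop : Continuous fun s : ℝ => Real.exp (-s ^ 2)).intervalIntegrable a b) 0

lemma tendsto_erf_atTop : Tendsto erf atTop (nhds 1) := by
  have hint : MeasureTheory.Integrable fun s : ℝ => Real.exp (-s ^ 2) := by
    simpa using integrable_exp_neg_mul_sq (b := 1) one_pos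
  have hval : ∫ s in Set.Ioi (0 : ℝ), Real.exp (-s ^ 2) = Real.sqrt π / 2 := by
    simpa using integral_gaussian_Ioi 1
  have h := (MeasureTheory.intervalIntegral_tendsto_integral_Ioi 0 hint.integrableOn
    tendsto_id).const_mul (2 / Real.sqrt π)
  rw [hval] at h
  have hpi : Real.sqrt π ≠ 0 := (Real.sqrt_pos.2 Real.pi_pos).ne'
  have hone : 2 / Real.sqrt π * (Real.sqrt π / 2) = 1 := by field_simp
  rw [hone] at h
  exact h

lemma continuous_lam : Continuous lam := by
  have := continuous_erf
  unfold lam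
  fun_prop

lemma tendsto_lam_div_atTop : Tendsto (fun s => lam s / s) atTop (nhds (Real.sqrt (π / 2))) := by
  have herf : Tendsto (fun s : ℝ => erf (s / Real.sqrt 2)) atTop (nhds 1) :=
    tendsto_erf_atTop.comp (tendsto_id.atTop_div_const (by positivity))
  have hexp : Tendsto (fun s : ℝ => Real.exp (-s ^ 2 / 2) / s) atTop (nhds 0) := by
    refine squeeze_zero' ?_ ?_ tendsto_inv_atTop_zero
    · filter_upwards [eventually_gt_atTop 0] with s hs
      positivity
    · filter_upwards [eventually_gt_atTop 0] with s hs
      rw [div_eq_mul_inv]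
      refine mul_le_of_le_one_left (by positivity) (Real.exp_le_one_iff.2 ?_)
      nlinarith [sq_nonneg s]
  have h := hexp.add (herf.const_mul (Real.sqrt (π / 2)))
  rw [zero_add, mul_one] at h
  refine h.congr' ?_
  filter_upwards [eventually_gt_atTop 0] with s hs
  unfold lam
  field_simp

lemma tendsto_lam_atTop : Tendsto lam atTop atTop := by
  have hc : 0 < Real.sqrt (π / 2) := Real.sqrt_pos.2 (by positivity)
  refine (tendsto_lam_div_atTop.pos_mul_atTop hc tendsto_id).congr' ?_
  filter_upwards [eventually_gt_atTop 0] with s hs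
  exact div_mul_cancel₀ _ hs.ne'

lemma mul_lam_eq_phiInf (x : ℝ) {r : ℝ} (hr : 0 < r) :
    r * lam (x * (Real.sqrt (π / 2))⁻¹ / r) = phiInf x r := by
  have hc : 0 < Real.sqrt (π / 2) := Real.sqrt_pos.2 (by positivity)
  have hsq : Real.sqrt (π / 2) ^ 2 = π / 2 := Real.sq_sqrt (by positivity)
  have hpi : Real.sqrt π = Real.sqrt (π / 2) * Real.sqrt 2 := by
    rw [← Real.sqrt_mul (by positivity)]
    congr 1
    ring
  have harg : -(x * (Real.sqrt (π / 2))⁻¹ / r) ^ 2 / 2 = -x ^ 2 / (π * r ^ 2) := by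
    rw [div_pow, mul_pow, inv_pow, hsq]
    field_simp
  have harg' : x * (Real.sqrt (π / 2))⁻¹ / r / Real.sqrt 2 = x / (Real.sqrt π * r) := by
    rw [hpi]
    field_simp
  unfold lam phiInf
  rw [if_neg hr.ne', abs_of_pos hr, harg, harg', mul_add]
  congr 1
  generalize erf (x / (Real.sqrt π * r)) = e
  generalize Real.sqrt (π / 2) = c at hc
  field_simp

theorem renormalized_suppFunction_tendsto_phiInf (x r : ℝ) (hr : 0 < r) :
    Tendsto (fun s =>
      Real.sqrt (x ^ 2 + lam s ^ 2 * r ^ 2) / lam s *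
        lam (x * s / Real.sqrt (x ^ 2 + lam s ^ 2 * r ^ 2)))
      atTop (nhds (phiInf x r)) := by
  have hc : 0 < Real.sqrt (π / 2) := Real.sqrt_pos.2 (by positivity)
  have hα : Tendsto (fun s => Real.sqrt (x ^ 2 + lam s ^ 2 * r ^ 2) / lam s) atTop (nhds r) := by
    have h := ((((tendsto_lam_atTop.const_div_atTop x).pow 2).add_const (r ^ 2))).sqrt
    rw [zero_pow two_ne_zero, zero_add, Real.sqrt_sq hr.le] at h
    refine h.congr' ?_
    filter_upwards [tendsto_lam_atTop.eventually_gt_atTop 0] with s hs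
    rw [eq_div_iff hs.ne', ← Real.sqrt_sq hs.le, ← Real.sqrt_mul (by positivity),
      Real.sqrt_sq hs.le]
    congr 1
    field_simp
  have hβ : Tendsto (fun s => x * s / Real.sqrt (x ^ 2 + lam s ^ 2 * r ^ 2)) atTop
      (nhds (x * (Real.sqrt (π / 2))⁻¹ / r)) := by
    refine (((tendsto_lam_div_atTop.inv₀ hc.ne').const_mul x).div hα hr.ne').congr' ?_
    filter_upwards [tendsto_lam_atTop.eventually_gt_atTop 0] with s hs
    have hroot : 0 < Real.sqrt (x ^ 2 + lam s ^ 2 * r ^ 2) := Real.sqrt_pos.2 (by positivity)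
    simp only [Pi.div_apply]
    rw [inv_div]
    field_simp
  rw [← mul_lam_eq_phiInf x hr]
  exact hα.mul ((continuous_lam.tendsto _).comp hβ)
end
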